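/- arXiv:2209.14093 — 2 statements merged into one kernel-verified Lean document; each statement's English description precedes it below -/
import Mathlib

section
/- Let T be a maximum-weight spanning tree of the weighted complete graph on C. Then the edge of T of minimum weight is unique, and it is precisely the (unique) edge of T having one endpoint in M and the other in C\M; every other edge of T has strictly greater weight. -/
open Finset SimpleGraph

namespace SimpleGraph

variable {V : Type*} {T : SimpleGraph V} {a b c x y : V}

/-- After deleting the edge `ab`, every vertex connected to `a` stays connected to `a` or `b`. -/
lemma Reachable.deleteEdges_left_or_right (h : T.Reachable a c) :
    (T.deleteEdges {s(a, b)}).Reachable a c ∨ (T.deleteEdges {s(a, b)}).Reachable b c := by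
  rw [reachable_iff_reflTransGen] at h
  induction h with
  | refl => exact .inl .rfl
  | @tail u v _ huv ih =>
    by_cases he : s(u, v) = s(a, b)
    · rcases Sym2.eq_iff.1 he with ⟨-, rfl⟩ | ⟨-, rfl⟩
      · exact .inr .rfl
      · exact .inl .rfl
    · have hadj : (T.deleteEdges {s(a, b)}).Adj u v := by simp [deleteEdges_adj, huv, he]
      exact ih.imp (·.trans hadj.reachable) (·.trans hadj.reachable)

lemma IsAcyclic.not_reachable_deleteEdges (hT : T.IsAcyclic) (hab : T.Adj a b) :
    ¬(T.deleteEdges {s(a, b)}).Reachable a b :=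
  isBridge_iff.1 (isAcyclic_iff_forall_adj_isBridge.1 hT hab)

/-- Exchanging the edge `ab` of a tree for an edge `xy` joining the two components of the
complement of `ab` gives a tree. -/
lemma IsTree.deleteEdges_sup_edge (hT : T.IsTree) (hab : T.Adj a b)
    (hax : (T.deleteEdges {s(a, b)}).Reachable a x)
    (hby : (T.deleteEdges {s(a, b)}).Reachable b y) :
    (T.deleteEdges {s(a, b)} ⊔ edge x y).IsTree := by
  have hnxy : ¬(T.deleteEdges {s(a, b)}).Reachable x y :=
    fun h ↦ hT.isAcyclic.not_reachable_deleteEdges hab ((hax.trans h).trans hby.symm)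
  have hxy : x ≠ y := fun h ↦ hnxy (h ▸ .rfl)
  refine ⟨?_, (hT.isAcyclic.anti (deleteEdges_le _)).sup_edge_of_not_reachable hnxy⟩
  have := hT.connected.nonempty
  have hadj : (T.deleteEdges {s(a, b)} ⊔ edge x y).Adj x y := by simp [edge_adj, hxy]
  have hreach : (T.deleteEdges {s(a, b)} ⊔ edge x y).Reachable a b :=
    ((hax.mono le_sup_left).trans hadj.reachable).trans (hby.symm.mono le_sup_left)
  refine ⟨fun u v ↦ ?_⟩
  have h := hT.connected u v
  rw [reachable_iff_reflTransGen] at h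
  induction h with
  | refl => exact .rfl
  | @tail u v _ huv ih =>
    refine ih.trans ?_
    by_cases he : s(u, v) = s(a, b)
    · rcases Sym2.eq_iff.1 he with ⟨rfl, rfl⟩ | ⟨rfl, rfl⟩
      · exact hreach
      · exact hreach.symm
    · refine Reachable.mono le_sup_left (Adj.reachable ?_)
      simp [deleteEdges_adj, huv, he]

/-- In a maximum-weight spanning tree, no edge joining the two components of the complement of a
tree edge is heavier than that tree edge. -/
lemma IsTree.weight_le_of_forall_sum_le [Finite V] (hT : T.IsTree) (w : Sym2 V → ℝ)
    (hmax : ∀ T' : SimpleGraph V, T'.IsTree →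
      ∑ e ∈ T'.edgeSet.toFinite.toFinset, w e ≤ ∑ e ∈ T.edgeSet.toFinite.toFinset, w e)
    (hab : T.Adj a b) (hax : (T.deleteEdges {s(a, b)}).Reachable a x)
    (hby : (T.deleteEdges {s(a, b)}).Reachable b y) : w s(x, y) ≤ w s(a, b) := by
  classical
  have hnxy : ¬(T.deleteEdges {s(a, b)}).Reachable x y :=
    fun h ↦ hT.isAcyclic.not_reachable_deleteEdges hab ((hax.trans h).trans hby.symm)
  have hxy : x ≠ y := fun h ↦ hnxy (h ▸ .rfl)
  have hmem : s(x, y) ∉ T.edgeSet.toFinite.toFinset.erase s(a, b) := fun h ↦ by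
    refine hnxy (Adj.reachable ?_)
    simpa [deleteEdges_adj, and_comm] using h
  have hset : (T.deleteEdges {s(a, b)} ⊔ edge x y).edgeSet.toFinite.toFinset =
      insert s(x, y) (T.edgeSet.toFinite.toFinset.erase s(a, b)) := by
    ext e
    simp [edgeSet_sup, edgeSet_deleteEdges, edgeSet_edge_of_ne hxy, and_comm]
  have hsum := hmax _ (hT.deleteEdges_sup_edge hab hax hby)
  rw [hset, sum_insert hmem] at hsum
  have := add_sum_erase T.edgeSet.toFinite.toFinset w (a := s(a, b)) (by simpa using hab)
  linarith

end SimpleGraph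

/-- In a maximum-weight spanning tree `T` of the weighted complete
graph on the client set, the minimum-weight edge is unique and it is precisely the
(unique) edge with one endpoint in the attacker set `M` and the other in `C \ M`;
every other edge of `T` has strictly greater weight. -/
theorem mst_min_edge_is_cross {V : Type*} [Fintype V] [DecidableEq V]
    (w : Sym2 V → ℝ) (M : Finset V)
    (hM : 2 ≤ M.card) (hN : 2 ≤ Mᶜ.card)
    (hsep : ∀ p ∈ M, ∀ q ∈ M, p ≠ q → ∀ i ∈ Mᶜ, ∀ j ∈ Mᶜ, i ≠ j →
      ∀ p' ∈ M, ∀ i' ∈ Mᶜ, w s(i', p') < w s(i, j) ∧ w s(i, j) < w s(p, q))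
    (T : SimpleGraph V) (hT : T.IsTree)
    (hmax : ∀ T' : SimpleGraph V, T'.IsTree →
      ∑ e ∈ T'.edgeSet.toFinite.toFinset, w e ≤ ∑ e ∈ T.edgeSet.toFinite.toFinset, w e) :
    ∃ e ∈ T.edgeSet,
      (∃ a b, a ∈ M ∧ b ∉ M ∧ e = s(a, b)) ∧
      (∀ f ∈ T.edgeSet, (∃ a b, a ∈ M ∧ b ∉ M ∧ f = s(a, b)) → f = e) ∧
      (∀ f ∈ T.edgeSet, f ≠ e → w e < w f) := by
  obtain ⟨p, hp, q, hq, hpq⟩ := one_lt_card.1 hM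
  obtain ⟨i, hi, j, hj, hij⟩ := one_lt_card.1 hN
  have hlt : ∀ a ∈ M, ∀ b ∉ M, ∀ x y, x ≠ y → (x ∈ M ↔ y ∈ M) → w s(a, b) < w s(x, y) := by
    intro a ha b hb x y hxy hiff
    rw [Sym2.eq_swap]
    by_cases hx : x ∈ M
    · obtain ⟨h₁, h₂⟩ := hsep x hx y (hiff.1 hx) hxy i hi j hj hij a ha b (mem_compl.2 hb)
      exact h₁.trans h₂
    · exact (hsep p hp q hq hpq x (mem_compl.2 hx) y (mem_compl.2 (mt hiff.2 hx)) hxy a ha b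
        (mem_compl.2 hb)).1
  obtain ⟨walk⟩ := hT.connected p i
  obtain ⟨d, -, ha, hb⟩ := walk.exists_boundary_dart (M : Set V) hp (by simpa using hi)
  obtain ⟨⟨a, b⟩, hab⟩ := d
  simp only [mem_coe] at ha hb hab
  have huniq : ∀ f ∈ T.edgeSet, (∃ a b, a ∈ M ∧ b ∉ M ∧ f = s(a, b)) → f = s(a, b) := by
    rintro _ hf ⟨c, d, hc, hd, rfl⟩
    by_contra hne
    have hcd : (T.deleteEdges {s(a, b)}).Adj c d := by
      simpa only [deleteEdges_adj, Set.mem_singleton_iff] using ⟨hf, hne⟩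
    have hnab := hT.isAcyclic.not_reachable_deleteEdges hab
    rcases (hT.connected a c).deleteEdges_left_or_right (b := b) with hac | hbc
    · have had := hac.trans hcd.reachable
      have hdb : d ≠ b := fun h ↦ hnab (h ▸ had)
      exact (hT.weight_le_of_forall_sum_le w hmax hab had .rfl).not_gt
        (hlt a ha b hb d b hdb (iff_of_false hd hb))
    · have hac : a ≠ c := fun h ↦ hnab (h ▸ hbc.symm)
      exact (hT.weight_le_of_forall_sum_le w hmax hab .rfl hbc).not_gt
        (hlt a ha b hb a c hac (iff_of_true ha hc))
  refine ⟨s(a, b), hab, ⟨a, b, ha, hb, rfl⟩, huniq, fun f hf hne ↦ ?_⟩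
  induction f with | _ x y
  refine hlt a ha b hb x y (T.ne_of_adj hf) ⟨fun hx ↦ ?_, fun hy ↦ ?_⟩
  · by_contra hy
    exact hne (huniq _ hf ⟨x, y, hx, hy, rfl⟩)
  · by_contra hx
    exact hne (huniq _ hf ⟨y, x, hy, hx, Sym2.eq_swap⟩)
end

section
/- Let T be a maximum-weight spanning tree of the weighted complete graph on C and let e be the unique minimum-weight edge of T. Then the graph obtained from T by deleting e has exactly two connected components, and their vertex sets are exactly M and C\M. -/
open Finset SimpleGraph

/-- Deleting one edge of a connected graph leaves every vertex reachable from one of its ends. -/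
theorem SimpleGraph.Connected.reachable_deleteEdges_or {V : Type*} {G : SimpleGraph V}
    (hG : G.Connected) (a b v : V) :
    (G.deleteEdges {s(a, b)}).Reachable a v ∨ (G.deleteEdges {s(a, b)}).Reachable b v := by
  by_contra hv
  obtain ⟨p⟩ := hG.preconnected a v
  obtain ⟨d, -, hd, hd'⟩ := p.exists_boundary_dart
    {v | (G.deleteEdges {s(a, b)}).Reachable a v ∨ (G.deleteEdges {s(a, b)}).Reachable b v}
    (Or.inl (Reachable.refl a)) hv
  apply hd'
  by_cases hab : s(d.fst, d.snd) = s(a, b)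
  · rcases Sym2.eq_iff.mp hab with ⟨-, h⟩ | ⟨-, h⟩
    · exact Or.inr (h ▸ Reachable.refl _)
    · exact Or.inl (h ▸ Reachable.refl _)
  · have hadj : (G.deleteEdges {s(a, b)}).Adj d.fst d.snd := deleteEdges_adj.mpr ⟨d.adj, hab⟩
    exact hd.imp (·.trans hadj.reachable) (·.trans hadj.reachable)

/-- Replacing an edge of a tree by any edge joining the two resulting components gives a tree. -/
theorem SimpleGraph.IsTree.deleteEdges_sup_edge_s4 {V : Type*} {T : SimpleGraph V}
    (hT : T.IsTree) {a b x y : V} (hab : T.Adj a b)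
    (hx : (T.deleteEdges {s(a, b)}).Reachable a x)
    (hy : (T.deleteEdges {s(a, b)}).Reachable b y) :
    ¬ (T.deleteEdges {s(a, b)}).Reachable x y ∧
      (T.deleteEdges {s(a, b)} ⊔ edge x y).IsTree := by
  have hxy : ¬ (T.deleteEdges {s(a, b)}).Reachable x y := fun h =>
    isAcyclic_iff_forall_adj_isBridge.mp hT.isAcyclic hab ((hx.trans h).trans hy.symm)
  refine ⟨hxy, ?_, ?_⟩
  · have hle : T.deleteEdges {s(a, b)} ≤ T.deleteEdges {s(a, b)} ⊔ edge x y := le_sup_left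
    have hne : x ≠ y := fun h => hxy (h ▸ Reachable.refl _)
    have hadj : (T.deleteEdges {s(a, b)} ⊔ edge x y).Adj x y := by
      simp [edge_adj, hne]
    have hba := ((hx.mono hle).trans hadj.reachable).trans (hy.mono hle).symm
    refine connected_iff_exists_forall_reachable _ |>.mpr ⟨a, fun v => ?_⟩
    rcases hT.connected.reachable_deleteEdges_or a b v with h | h
    · exact h.mono hle
    · exact hba.trans (h.mono hle)
  · exact (hT.isAcyclic.anti (deleteEdges_le _)).sup_edge_of_not_reachable hxy

/-- In a maximum-weight spanning tree, no edge across the cut defined by a tree edge is heavier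
than that tree edge. -/
theorem weight_le_of_reachable_deleteEdges {V : Type*} [Finite V]
    {w : Sym2 V → ℝ} {T : SimpleGraph V} (hT : T.IsTree)
    (hmax : ∀ T' : SimpleGraph V, T'.IsTree →
      ∑ e ∈ T'.edgeSet.toFinite.toFinset, w e ≤ ∑ e ∈ T.edgeSet.toFinite.toFinset, w e)
    {a b x y : V} (hab : T.Adj a b)
    (hx : (T.deleteEdges {s(a, b)}).Reachable a x)
    (hy : (T.deleteEdges {s(a, b)}).Reachable b y) :
    w s(x, y) ≤ w s(a, b) := by
  classical
  obtain ⟨hxy, hT'⟩ := hT.deleteEdges_sup_edge_s4 hab hx hy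
  have hne : x ≠ y := fun h => hxy (h ▸ Reachable.refl _)
  have hnot : s(x, y) ∉ (T.deleteEdges {s(a, b)}).edgeSet.toFinite.toFinset := by
    rw [Set.Finite.mem_toFinset]
    exact fun h => hxy (Adj.reachable h)
  have hnot' : s(a, b) ∉ (T.deleteEdges {s(a, b)}).edgeSet.toFinite.toFinset := by
    simp
  have hins : (T.deleteEdges {s(a, b)} ⊔ edge x y).edgeSet.toFinite.toFinset =
      insert s(x, y) (T.deleteEdges {s(a, b)}).edgeSet.toFinite.toFinset := by
    ext f
    simp only [Set.Finite.mem_toFinset, edgeSet_sup, edgeSet_edge_of_ne hne, Finset.mem_insert,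
      Set.mem_union, Set.mem_singleton_iff, or_comm]
  have hins' : T.edgeSet.toFinite.toFinset =
      insert s(a, b) (T.deleteEdges {s(a, b)}).edgeSet.toFinite.toFinset := by
    ext f
    simp only [Set.Finite.mem_toFinset, edgeSet_deleteEdges, Finset.mem_insert, Set.mem_sdiff,
      Set.mem_singleton_iff]
    have : s(a, b) ∈ T.edgeSet := hab
    grind
  have h := hmax _ hT'
  rw [hins, hins', Finset.sum_insert hnot, Finset.sum_insert hnot'] at h
  linarith

open Finset SimpleGraph

/-- Let `T` be a maximum-weight spanning tree of the weighted complete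
graph on the client set and let `e` be the unique minimum-weight edge of `T`.  Then
deleting `e` from `T` yields exactly two connected components, whose vertex sets are
exactly the attacker set `M` and the normal set `C \ M`. -/
theorem mst_delete_min_edge_components {V : Type*} [Fintype V] [DecidableEq V]
    (w : Sym2 V → ℝ) (M : Finset V)
    (hM : 2 ≤ M.card) (hN : 2 ≤ Mᶜ.card)
    (hsep : ∀ p ∈ M, ∀ q ∈ M, p ≠ q → ∀ i ∈ Mᶜ, ∀ j ∈ Mᶜ, i ≠ j →
      ∀ p' ∈ M, ∀ i' ∈ Mᶜ, w s(i', p') < w s(i, j) ∧ w s(i, j) < w s(p, q))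
    (T : SimpleGraph V) (hT : T.IsTree)
    (hmax : ∀ T' : SimpleGraph V, T'.IsTree →
      ∑ e ∈ T'.edgeSet.toFinite.toFinset, w e ≤ ∑ e ∈ T.edgeSet.toFinite.toFinset, w e)
    (e : Sym2 V) (he : e ∈ T.edgeSet)
    (hmin : ∀ f ∈ T.edgeSet, f ≠ e → w e < w f) :
    ∃ c₁ c₂ : (T.deleteEdges {e}).ConnectedComponent,
      c₁ ≠ c₂ ∧ (∀ c : (T.deleteEdges {e}).ConnectedComponent, c = c₁ ∨ c = c₂) ∧
      c₁.supp = (↑M : Set V) ∧ c₂.supp = (↑(Mᶜ) : Set V) := by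
  have hcross : ∀ p ∈ M, ∀ i ∉ M, ∀ x y, x ≠ y → (x ∈ M ↔ y ∈ M) → w s(p, i) < w s(x, y) := by
    intro p hp i hi x y hxy hiff
    obtain ⟨q₁, hq₁, q₂, hq₂, hq⟩ := Finset.one_lt_card.mp hM
    obtain ⟨j₁, hj₁, j₂, hj₂, hj⟩ := Finset.one_lt_card.mp hN
    rw [Sym2.eq_swap]
    by_cases hx : x ∈ M
    · have h := hsep x hx y (hiff.mp hx) hxy j₁ hj₁ j₂ hj₂ hj p hp i (by simpa using hi)
      exact h.1.trans h.2
    · exact (hsep q₁ hq₁ q₂ hq₂ hq x (by simpa using hx) y (by simpa [← hiff] using hx) hxy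
        p hp i (by simpa using hi)).1
  obtain ⟨a, b, ha, hb, rfl⟩ : ∃ a b, a ∈ M ∧ b ∉ M ∧ s(a, b) = e := by
    obtain ⟨p, hp⟩ := Finset.card_pos.mp (by omega : 0 < M.card)
    obtain ⟨i, hi⟩ := Finset.card_pos.mp (by omega : 0 < Mᶜ.card)
    obtain ⟨W⟩ := hT.connected.preconnected p i
    obtain ⟨d, -, hd, hd'⟩ := W.exists_boundary_dart (↑M : Set V) hp (by simpa using hi)
    by_contra hne
    have hlt := hmin s(d.fst, d.snd) d.adj fun h => hne ⟨_, _, hd, hd', h⟩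
    induction e with | h x y =>
    refine lt_asymm hlt (hcross _ hd _ hd' x y (Adj.ne he) ?_)
    by_contra hiff
    by_cases hx : x ∈ M
    · exact hne ⟨x, y, hx, by tauto, rfl⟩
    · exact hne ⟨y, x, by tauto, hx, Sym2.eq_swap⟩
  have hab : T.Adj a b := he
  have hcut : ∀ x y, (T.deleteEdges {s(a, b)}).Reachable a x →
      (T.deleteEdges {s(a, b)}).Reachable b y → ¬ (x ∈ M ↔ y ∈ M) := by
    intro x y hx hy hiff
    have hne : x ≠ y := fun h => (hT.deleteEdges_sup_edge_s4 hab hx hy).1 (h ▸ Reachable.refl _)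
    exact (hcross a ha b hb x y hne hiff).not_ge
      (weight_le_of_reachable_deleteEdges hT hmax hab hx hy)
  have hA : ∀ x, (T.deleteEdges {s(a, b)}).Reachable a x → x ∈ M := fun x hx => by
    have := hcut x b hx (Reachable.refl b)
    tauto
  have hB : ∀ y, (T.deleteEdges {s(a, b)}).Reachable b y → y ∉ M := fun y hy => by
    have := hcut a y (Reachable.refl a) hy
    tauto
  have hor := hT.connected.reachable_deleteEdges_or a b
  refine ⟨connectedComponentMk _ a, connectedComponentMk _ b, ?_, ?_, ?_, ?_⟩
  · exact fun h => hb (hA b (ConnectedComponent.exact h))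
  · intro c
    induction c using ConnectedComponent.ind with | h v =>
    exact (hor v).imp (fun h => ConnectedComponent.sound h.symm)
      (fun h => ConnectedComponent.sound h.symm)
  · ext v
    rw [ConnectedComponent.mem_supp_iff, ConnectedComponent.eq, reachable_comm, Finset.mem_coe]
    exact ⟨hA v, fun hv => (hor v).resolve_right fun h => hB v h hv⟩
  · ext v
    rw [ConnectedComponent.mem_supp_iff, ConnectedComponent.eq, reachable_comm, Finset.mem_coe,
      Finset.mem_compl]
    exact ⟨hB v, fun hv => (hor v).resolve_left fun h => hv (hA v h)⟩
end
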